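/- arXiv:1512.04702 — 6 statements merged into one kernel-verified Lean document; each statement's English description precedes it below -/
import Mathlib

section
/- Let F : [0,∞) → ℝ be differentiable and bounded from below, and suppose there exists an integrable function G ∈ L¹([0,∞)) such that F'(t) ≤ G(t) for almost every t ∈ [0,∞). Then lim_{t→∞} F(t) exists and is a real number. -/
open Filter MeasureTheory Set

/-- If the derivative of `F` on `[0,∞)` is a.e. bounded above by an integrable function `G`,
then the increments of `F` are bounded above by the integrals of `G`. -/
theorem sub_le_integral_of_hasDerivWithinAt_ae_le {F F' G : ℝ → ℝ}
    (hdiff : ∀ t ∈ Ici (0 : ℝ), HasDerivWithinAt F (F' t) (Ici 0) t)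
    (hG : IntegrableOn G (Ici 0))
    (hle : ∀ᵐ t ∂(volume.restrict (Ici (0 : ℝ))), F' t ≤ G t)
    {a b : ℝ} (ha : 0 ≤ a) (hab : a ≤ b) :
    F b - F a ≤ ∫ t in a..b, G t := by
  have hsub : Icc a b ⊆ Ici (0 : ℝ) := fun x hx => ha.trans hx.1
  have hae : G =ᵐ[volume.restrict (Ici (0 : ℝ))] fun t => max (F' t) (G t) := by
    filter_upwards [hle] with t ht
    exact (max_eq_right ht).symm
  have hint : IntegrableOn (fun t => max (F' t) (G t)) (Icc a b) :=
    IntegrableOn.mono_set (Integrable.congr hG hae) hsub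
  have key := intervalIntegral.sub_le_integral_of_hasDeriv_right_of_le hab
    (fun x hx => ((hdiff x (hsub hx)).continuousWithinAt).mono hsub)
    (fun x hx => (hdiff x (hsub (Ioo_subset_Icc_self hx))).mono
      (fun y hy => mem_Ici.2 ((ha.trans hx.1.le).trans (mem_Ioi.1 hy).le)))
    hint (fun x _ => le_max_left _ _)
  refine key.trans_eq ?_
  rw [intervalIntegral.integral_of_le hab, intervalIntegral.integral_of_le hab]
  exact integral_congr_ae
    (ae_restrict_of_ae_restrict_of_subset (Ioc_subset_Icc_self.trans hsub) hae.symm)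

/-- If `F : [0,∞) → ℝ` is differentiable (with derivative `F'`) and bounded from below,
and there is `G ∈ L¹([0,∞))` with `F'(t) ≤ G(t)` for almost every `t ≥ 0`,
then `lim_{t → ∞} F(t)` exists in `ℝ`. -/
theorem stmt0 (F F' G : ℝ → ℝ)
    (hdiff : ∀ t ∈ Ici (0 : ℝ), HasDerivWithinAt F (F' t) (Ici 0) t)
    (hbdd : BddBelow (F '' Ici 0))
    (hG : IntegrableOn G (Ici 0))
    (hle : ∀ᵐ t ∂(volume.restrict (Ici (0 : ℝ))), F' t ≤ G t) :
    ∃ L : ℝ, Tendsto F atTop (nhds L) := by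
  have hii : ∀ a b : ℝ, 0 ≤ a → 0 ≤ b → IntervalIntegrable G volume a b := fun a b ha hb =>
    (hG.mono_set fun x hx => (le_min ha hb).trans hx.1).intervalIntegrable
  have hlim : Tendsto (fun t => ∫ s in (0 : ℝ)..t, G s) atTop (nhds (∫ s in Ioi (0 : ℝ), G s)) :=
    intervalIntegral_tendsto_integral_Ioi 0 (hG.mono_set Ioi_subset_Ici_self) tendsto_id
  obtain ⟨m, hm⟩ := hbdd
  let H : ℝ → ℝ := fun t => F (max t 0) - ∫ s in (0 : ℝ)..(max t 0), G s
  have hanti : Antitone H := by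
    intro a b hab
    have h0 : (0 : ℝ) ≤ max a 0 := le_max_right _ _
    have h1 : max a 0 ≤ max b 0 := max_le_max_right 0 hab
    have h2 := sub_le_integral_of_hasDerivWithinAt_ae_le hdiff hG hle h0 h1
    have h3 := intervalIntegral.integral_add_adjacent_intervals (hii 0 _ le_rfl h0)
      (hii _ _ h0 (h0.trans h1))
    simp only [H]
    linarith
  have hbelow : BddBelow (range H) := by
    refine ⟨m - ∫ s in Ici (0 : ℝ), |G s|, ?_⟩
    rintro _ ⟨t, rfl⟩
    have h0 : (0 : ℝ) ≤ max t 0 := le_max_right _ _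
    have h1 : m ≤ F (max t 0) := hm (mem_image_of_mem F h0)
    have h2 : ∫ s in (0 : ℝ)..(max t 0), G s ≤ ∫ s in Ici (0 : ℝ), |G s| := by
      calc ∫ s in (0 : ℝ)..(max t 0), G s ≤ ∫ s in (0 : ℝ)..(max t 0), |G s| :=
            intervalIntegral.integral_mono_on h0 (hii _ _ le_rfl h0) (hii _ _ le_rfl h0).abs
              fun x _ => le_abs_self _
        _ = ∫ s in Ioc (0 : ℝ) (max t 0), |G s| := intervalIntegral.integral_of_le h0
        _ ≤ ∫ s in Ici (0 : ℝ), |G s| :=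
            setIntegral_mono_set (Integrable.abs hG) (Eventually.of_forall fun x => abs_nonneg _)
              (Eventually.of_forall fun x hx => le_of_lt hx.1)
    simp only [H]
    linarith
  refine ⟨_, ((tendsto_atTop_ciInf hanti hbelow).add hlim).congr' ?_⟩
  filter_upwards [eventually_ge_atTop (0 : ℝ)] with t ht
  simp [H, max_eq_left ht]
end

section
/- Let γ > 0 and let F : [0,∞) → ℝ be twice differentiable and bounded from below, and suppose there exists an integrable function G ∈ L¹([0,∞)) such that F''(t) + γ F'(t) ≤ G(t) for almost every t ∈ [0,∞). Then lim_{t→∞} F(t) exists and is a real number. -/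
open Filter MeasureTheory Set

/-- If `F' + γ F ≤ γ c` eventually, then `F` is eventually below any level `a > c`. -/
theorem eventually_lt_of_deriv_add_mul_le {γ : ℝ} (hγ : 0 < γ) {F F' : ℝ → ℝ} {c a : ℝ}
    (hF : ∀ᶠ t in atTop, HasDerivAt F (F' t) t)
    (hle : ∀ᶠ t in atTop, F' t + γ * F t ≤ γ * c) (hca : c < a) :
    ∀ᶠ t in atTop, F t < a := by
  obtain ⟨T, hT⟩ := eventually_atTop.1 (hF.and hle)
  have hderiv : ∀ t ∈ Ici T, HasDerivAt (fun s => Real.exp (γ * s) * (F s - c))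
      (Real.exp (γ * t) * (F' t + γ * F t - γ * c)) t := fun t ht => by
    have h1 : HasDerivAt (fun s : ℝ => Real.exp (γ * s)) (Real.exp (γ * t) * (γ * 1)) t :=
      ((hasDerivAt_id t).const_mul γ).exp
    exact (h1.mul ((hT t ht).1.sub_const c)).congr_deriv (by ring)
  have hanti : AntitoneOn (fun s => Real.exp (γ * s) * (F s - c)) (Ici T) := by
    refine antitoneOn_of_deriv_nonpos (convex_Ici T)
      (fun t ht => (hderiv t ht).continuousAt.continuousWithinAt)
      (fun t ht => (hderiv t (interior_subset ht)).differentiableAt.differentiableWithinAt)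
      fun t ht => ?_
    rw [(hderiv t (interior_subset ht)).deriv]
    exact mul_nonpos_of_nonneg_of_nonpos (Real.exp_pos _).le
      (sub_nonpos.2 (hT t (interior_subset ht)).2)
  have hlim : Tendsto (fun t : ℝ => Real.exp (γ * t) * (a - c)) atTop atTop :=
    (Real.tendsto_exp_atTop.comp (tendsto_id.const_mul_atTop hγ)).atTop_mul_const
      (sub_pos.2 hca)
  filter_upwards [hlim.eventually_gt_atTop (Real.exp (γ * T) * (F T - c)),
    eventually_ge_atTop T] with t h1 h2
  have h3 := lt_of_mul_lt_mul_left ((hanti self_mem_Ici h2 h2).trans_lt h1) (Real.exp_pos _).le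
  linarith

/-- If `F' + γ F` converges to `l`, then `F` converges to `l / γ`. -/
theorem tendsto_div_of_tendsto_deriv_add_mul {γ : ℝ} (hγ : 0 < γ) {F F' : ℝ → ℝ} {l : ℝ}
    (hF : ∀ᶠ t in atTop, HasDerivAt F (F' t) t)
    (hl : Tendsto (fun t => F' t + γ * F t) atTop (nhds l)) :
    Tendsto F atTop (nhds (l / γ)) := by
  refine tendsto_order.2 ⟨fun a ha => ?_, fun a ha => ?_⟩
  · obtain ⟨c, hac, hc⟩ := exists_between ha
    have hlt : γ * c < l := by rwa [lt_div_iff₀' hγ] at hc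
    have := eventually_lt_of_deriv_add_mul_le (F := fun t => -F t) (F' := fun t => -F' t)
      (c := -c) (a := -a) hγ (hF.mono fun t ht => ht.neg)
      ((hl.eventually_const_lt hlt).mono fun t ht => by linarith) (neg_lt_neg hac)
    exact this.mono fun t ht => neg_lt_neg_iff.1 ht
  · obtain ⟨c, hc, hca⟩ := exists_between ha
    have hlt : l < γ * c := by rwa [div_lt_iff₀' hγ] at hc
    exact eventually_lt_of_deriv_add_mul_le hγ hF
      ((hl.eventually_lt_const hlt).mono fun t ht => ht.le) hca

/-- A function on `[0,∞)` whose derivative is almost everywhere bounded above by an integrable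
function either tends to `-∞` or converges. -/
theorem tendsto_atBot_or_of_deriv_le_integrable {u u' G : ℝ → ℝ}
    (hu : ∀ t ∈ Ici (0 : ℝ), HasDerivWithinAt u (u' t) (Ici 0) t)
    (hG : IntegrableOn G (Ici 0))
    (hle : ∀ᵐ t ∂(volume.restrict (Ici (0 : ℝ))), u' t ≤ G t) :
    Tendsto u atTop atBot ∨ ∃ l : ℝ, Tendsto u atTop (nhds l) := by
  set φ : ℝ → ℝ := fun t => max (u' t) (G t)
  have hφ : IntegrableOn φ (Ici 0) :=
    hG.congr_fun_ae (hle.mono fun t ht => (max_eq_right ht).symm)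
  have hint : ∀ a b : ℝ, 0 ≤ a → 0 ≤ b → IntervalIntegrable φ volume a b := fun a b ha hb =>
    (hφ.mono_set fun x hx => (le_min ha hb).trans hx.1).intervalIntegrable
  have hanti : Antitone fun t => u (max t 0) - ∫ s in (0 : ℝ)..max t 0, φ s := by
    intro s t hst
    have h0 : 0 ≤ max s 0 := le_max_right _ _
    have h0' : 0 ≤ max t 0 := le_max_right _ _
    have hst' : max s 0 ≤ max t 0 := max_le_max_right _ hst
    have h1 := intervalIntegral.sub_le_integral_of_hasDeriv_right_of_le hst'
      (fun x hx => ((hu x (h0.trans hx.1)).continuousWithinAt).mono fun y hy => h0.trans hy.1)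
      (fun x hx => (hu x (h0.trans hx.1.le)).mono fun y hy => (h0.trans hx.1.le).trans hy.le)
      (hφ.mono_set fun y hy => h0.trans hy.1) (fun x _ => le_max_left (u' x) (G x))
    have h2 := intervalIntegral.integral_add_adjacent_intervals
      (hint 0 _ le_rfl h0) (hint _ _ h0 h0')
    simp only [φ] at h2 ⊢
    linarith
  have hI : Tendsto (fun t => ∫ s in (0 : ℝ)..t, φ s) atTop (nhds (∫ s in Ioi 0, φ s)) :=
    intervalIntegral_tendsto_integral_Ioi 0 (hφ.mono_set Ioi_subset_Ici_self) tendsto_id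
  have heq : (fun t => (u (max t 0) - ∫ s in (0 : ℝ)..max t 0, φ s) + ∫ s in (0 : ℝ)..t, φ s)
      =ᶠ[atTop] u := by
    filter_upwards [eventually_ge_atTop 0] with t ht
    simp [max_eq_left ht]
  rcases tendsto_atTop_of_antitone hanti with h | ⟨l, h⟩
  · exact Or.inl ((h.atBot_add hI).congr' heq)
  · exact Or.inr ⟨_, (h.add hI).congr' heq⟩

/-- If `γ > 0` and `F : [0,∞) → ℝ` is twice differentiable (with first derivative `F'`
and second derivative `F''`) and bounded from below, and there is `G ∈ L¹([0,∞))` with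
`F''(t) + γ F'(t) ≤ G(t)` for almost every `t ≥ 0`, then `lim_{t → ∞} F(t)` exists in `ℝ`. -/
theorem stmt1 (γ : ℝ) (hγ : 0 < γ) (F F' F'' G : ℝ → ℝ)
    (hdiff : ∀ t ∈ Ici (0 : ℝ), HasDerivWithinAt F (F' t) (Ici 0) t)
    (hdiff2 : ∀ t ∈ Ici (0 : ℝ), HasDerivWithinAt F' (F'' t) (Ici 0) t)
    (hbdd : BddBelow (F '' Ici 0))
    (hG : IntegrableOn G (Ici 0))
    (hle : ∀ᵐ t ∂(volume.restrict (Ici (0 : ℝ))), F'' t + γ * F' t ≤ G t) :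
    ∃ L : ℝ, Tendsto F atTop (nhds L) := by
  have hF : ∀ᶠ t in atTop, HasDerivAt F (F' t) t := by
    filter_upwards [eventually_gt_atTop 0] with t ht
    exact (hdiff t ht.le).hasDerivAt (Ici_mem_nhds ht)
  have hu : ∀ t ∈ Ici (0 : ℝ),
      HasDerivWithinAt (fun s => F' s + γ * F s) (F'' t + γ * F' t) (Ici 0) t :=
    fun t ht => (hdiff2 t ht).add ((hdiff t ht).const_mul γ)
  rcases tendsto_atBot_or_of_deriv_le_integrable hu hG hle with h | ⟨l, h⟩
  · obtain ⟨m, hm⟩ := hbdd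
    have hlt := eventually_lt_of_deriv_add_mul_le hγ hF
      (h.eventually_le_atBot (γ * (m - 1))) (sub_one_lt m)
    obtain ⟨t, h1, h2⟩ := (hlt.and (eventually_ge_atTop 0)).exists
    exact absurd (hm (mem_image_of_mem F h2)) h1.not_ge
  · exact ⟨_, tendsto_div_of_tendsto_deriv_add_mul hγ hF h⟩
end

section
/- (Continuous Opial Lemma) Let S be a nonempty subset of a real Hilbert space H and x : [0,∞) → H a function such that (i) lim_{t→∞} ‖x(t) − z‖ exists for every z ∈ S, and (ii) every weak sequential limit point of x (i.e., every weak limit of a sequence x(t_n) with t_n → ∞) belongs to S. Then there exists x_∞ ∈ S such that x(t) converges weakly to x_∞ as t → ∞. -/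
open Filter Set RealInnerProductSpace

/-- Bounded sequences in a real Hilbert space have weakly convergent subsequences. -/
theorem exists_subseq_tendsto_inner {H : Type*} [NormedAddCommGroup H] [InnerProductSpace ℝ H]
    [CompleteSpace H] (u : ℕ → H) (C : ℝ) (hu : ∀ n, ‖u n‖ ≤ C) :
    ∃ (w : H) (φ : ℕ → ℕ), StrictMono φ ∧
      ∀ y : H, Tendsto (fun n => ⟪u (φ n), y⟫) atTop (nhds ⟪w, y⟫) := by
  let K : Submodule ℝ H := (Submodule.span ℝ (range u)).topologicalClosure
  have hK : IsClosed (K : Set H) := Submodule.isClosed_topologicalClosure _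
  have : CompleteSpace K := hK.completeSpace_coe
  have : TopologicalSpace.SeparableSpace K :=
    ((countable_range u).isSeparable.span (R := ℝ)).closure.separableSpace
  have hmem (n : ℕ) : u n ∈ K :=
    Submodule.le_topologicalClosure _ (Submodule.subset_span (mem_range_self n))
  let f (n : ℕ) : WeakDual ℝ K :=
    StrongDual.toWeakDual (InnerProductSpace.toDual ℝ K ⟨u n, hmem n⟩)
  have hf (n : ℕ) : f n ∈ WeakDual.toStrongDual ⁻¹' Metric.closedBall (0 : StrongDual ℝ K) C := by
    have : ‖InnerProductSpace.toDual ℝ K ⟨u n, hmem n⟩‖ ≤ C := by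
      rw [LinearIsometryEquiv.norm_map]
      exact hu n
    exact mem_closedBall_zero_iff.2 this
  obtain ⟨g, -, φ, hφ, hg⟩ := WeakDual.isSeqCompact_closedBall ℝ K 0 C hf
  refine ⟨(InnerProductSpace.toDual ℝ K).symm (WeakDual.toStrongDual g), φ, hφ, fun y => ?_⟩
  have hy := ((WeakDual.eval_continuous (K.orthogonalProjectionOnto y)).tendsto g).comp hg
  rw [← Submodule.inner_orthogonalProjectionOnto_eq_of_mem_left,
    InnerProductSpace.toDual_symm_apply]
  refine hy.congr fun n => ?_
  exact Submodule.inner_orthogonalProjectionOnto_eq_of_mem_left (⟨u (φ n), hmem (φ n)⟩ : K) y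

/-- If the distances from `x` to `v` and to `w` converge along `l`, so does `⟪x, v - w⟫`. -/
theorem exists_tendsto_inner_sub {α H : Type*} [NormedAddCommGroup H] [InnerProductSpace ℝ H]
    {l : Filter α} {x : α → H} {v w : H}
    (hv : ∃ L : ℝ, Tendsto (fun t => ‖x t - v‖) l (nhds L))
    (hw : ∃ L : ℝ, Tendsto (fun t => ‖x t - w‖) l (nhds L)) :
    ∃ L : ℝ, Tendsto (fun t => ⟪x t, v - w⟫) l (nhds L) := by
  obtain ⟨a, ha⟩ := hv
  obtain ⟨b, hb⟩ := hw
  refine ⟨(b ^ 2 - a ^ 2 + ‖v‖ ^ 2 - ‖w‖ ^ 2) / 2,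
    (((((hb.pow 2).sub (ha.pow 2)).add_const (‖v‖ ^ 2)).sub_const (‖w‖ ^ 2)).div_const
      2).congr fun t => ?_⟩
  rw [norm_sub_sq_real, norm_sub_sq_real, inner_sub_right]
  ring

/-- Continuous Opial Lemma: let `S` be a nonempty subset of a real Hilbert space `H`
and `x : [0,∞) → H` be such that `lim_{t→∞} ‖x(t) - z‖` exists for every `z ∈ S` and every
weak sequential limit point of `x` belongs to `S`. Then `x(t)` converges weakly, as `t → ∞`,
to some `x_∞ ∈ S`. (Weak convergence is expressed via inner products.) -/
theorem stmt2 {H : Type*} [NormedAddCommGroup H] [InnerProductSpace ℝ H] [CompleteSpace H]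
    (S : Set H) (hS : S.Nonempty) (x : ℝ → H)
    (h1 : ∀ z ∈ S, ∃ L : ℝ, Tendsto (fun t => ‖x t - z‖) atTop (nhds L))
    (h2 : ∀ (w : H) (t : ℕ → ℝ), Tendsto t atTop atTop →
      (∀ y : H, Tendsto (fun n => ⟪x (t n), y⟫) atTop (nhds ⟪w, y⟫)) → w ∈ S) :
    ∃ xinf ∈ S, ∀ y : H, Tendsto (fun s => ⟪x s, y⟫) atTop (nhds ⟪xinf, y⟫) := by
  have hsub (t : ℕ → ℝ) (ht : Tendsto t atTop atTop) : ∃ w ∈ S, ∃ ψ : ℕ → ℕ,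
      Tendsto ψ atTop atTop ∧ ∀ y : H, Tendsto (fun n => ⟪x (t (ψ n)), y⟫) atTop (nhds ⟪w, y⟫) := by
    obtain ⟨z, hz⟩ := hS
    obtain ⟨L, hL⟩ := h1 z hz
    obtain ⟨N, hN⟩ :=
      eventually_atTop.1 ((hL.comp ht).eventually (ge_mem_nhds (lt_add_one L)))
    obtain ⟨w, φ, hφ, hw⟩ := exists_subseq_tendsto_inner (fun n => x (t (n + N))) (L + 1 + ‖z‖)
      fun n => by
        have h : ‖x (t (n + N)) - z‖ ≤ L + 1 := hN (n + N) (Nat.le_add_left N n)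
        linarith [norm_le_norm_sub_add (x (t (n + N))) z]
    have hψ : Tendsto (fun n => φ n + N) atTop atTop :=
      tendsto_atTop_mono (fun n => Nat.le_add_right (φ n) N) hφ.tendsto_atTop
    exact ⟨w, h2 w (fun n => t (φ n + N)) (ht.comp hψ) hw, _, hψ, hw⟩
  obtain ⟨v, hv, ψ, hψ, hvlim⟩ := hsub (fun n => n) tendsto_natCast_atTop_atTop
  refine ⟨v, hv, fun y => tendsto_of_subseq_tendsto fun t ht => ?_⟩
  obtain ⟨w, hw, ξ, hξ, hwlim⟩ := hsub t ht
  obtain ⟨L, hL⟩ := exists_tendsto_inner_sub (h1 v hv) (h1 w hw)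
  have hvL : ⟪v, v - w⟫ = L := tendsto_nhds_unique (hvlim (v - w))
    (hL.comp (tendsto_natCast_atTop_atTop.comp hψ))
  have hwL : ⟪w, v - w⟫ = L := tendsto_nhds_unique (hwlim (v - w)) (hL.comp (ht.comp hξ))
  have hvw : v = w := by
    rw [← sub_eq_zero, ← inner_self_eq_zero (𝕜 := ℝ), inner_sub_left, hvL, hwL, sub_self]
  exact ⟨ξ, hvw ▸ hwlim y⟩
end

section
/- Under the stated hypotheses, the trajectory x and its derivative ẋ are bounded on [0,∞), i.e., sup_{t≥0} ‖x(t)‖ < ∞ and sup_{t≥0} ‖ẋ(t)‖ < ∞. -/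
open Filter MeasureTheory Set RealInnerProductSpace

/-- First-order lower bound for a differentiable convex function. -/
lemma ConvexOn.inner_gradient_le_sub {H : Type*} [NormedAddCommGroup H] [InnerProductSpace ℝ H]
    [CompleteSpace H] {f : H → ℝ} (hf : ConvexOn ℝ univ f) {a : H}
    (hd : DifferentiableAt ℝ f a) (b : H) : ⟪gradient f a, b - a⟫ ≤ f b - f a := by
  have hconv : ConvexOn ℝ univ (f ∘ AffineMap.lineMap (k := ℝ) a b) := by
    simpa using hf.comp_affineMap (AffineMap.lineMap (k := ℝ) a b)
  have hline : HasDerivAt (f ∘ AffineMap.lineMap (k := ℝ) a b) (fderiv ℝ f a (b - a)) 0 := by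
    refine HasFDerivAt.comp_hasDerivAt (0 : ℝ) ?_ AffineMap.hasDerivAt_lineMap
    simpa using hd.hasFDerivAt
  have h := hconv.le_slope_of_hasDerivWithinAt (mem_univ (0 : ℝ)) (mem_univ (1 : ℝ)) one_pos
    hline.hasDerivWithinAt
  rw [inner_gradient_left]
  simpa [slope_def_field] using h

/-- First-order optimality condition for minimizing a differentiable function on a convex set. -/
lemma IsMinOn.inner_gradient_sub_nonneg {H : Type*} [NormedAddCommGroup H]
    [InnerProductSpace ℝ H] [CompleteSpace H] {f : H → ℝ} {s : Set H} {a b : H}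
    (h : IsMinOn f s a) (hs : Convex ℝ s) (hd : DifferentiableAt ℝ f a) (ha : a ∈ s)
    (hb : b ∈ s) : 0 ≤ ⟪gradient f a, b - a⟫ := by
  rw [inner_gradient_left]
  exact h.localize.hasFDerivWithinAt_nonneg hd.hasFDerivAt.hasFDerivWithinAt
    (sub_mem_posTangentConeAt_of_segment_subset (hs.segment_subset ha hb))

/-- A function whose continuous derivative has an integrable majorant is bounded above. -/
lemma exists_forall_le_of_ofReal_deriv_le {f f' : ℝ → ℝ} {g : ℝ → ENNReal}
    (hf : ∀ t ∈ Ici (0 : ℝ), HasDerivWithinAt f (f' t) (Ici 0) t)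
    (hf' : ContinuousOn f' (Ici 0)) (hle : ∀ t ∈ Ici (0 : ℝ), ENNReal.ofReal (f' t) ≤ g t)
    (hg : ∫⁻ t in Ici (0 : ℝ), g t ≠ ⊤) : ∃ M : ℝ, ∀ t ∈ Ici (0 : ℝ), f t ≤ M := by
  refine ⟨f 0 + (∫⁻ t in Ici (0 : ℝ), g t).toReal, fun t ht => ?_⟩
  have ht0 : (0 : ℝ) ≤ t := ht
  have hint : IntegrableOn f' (Icc 0 t) :=
    (hf'.mono Icc_subset_Ici_self).integrableOn_Icc
  have hftc : ∫ s in (0 : ℝ)..t, f' s = f t - f 0 :=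
    intervalIntegral.integral_eq_sub_of_hasDeriv_right_of_le_real ht0
      (fun s hs => ((hf s hs.1).continuousWithinAt).mono Icc_subset_Ici_self)
      (fun s hs => (hf s hs.1.le).mono (Ioi_subset_Ici hs.1.le)) hint
  rw [intervalIntegral.integral_of_le ht0,
    integral_eq_lintegral_pos_part_sub_lintegral_neg_part
      (hint.mono_set Ioc_subset_Icc_self)] at hftc
  have hmono : ∫⁻ s in Ioc 0 t, ENNReal.ofReal (f' s) ≤ ∫⁻ s in Ici (0 : ℝ), g s :=
    (setLIntegral_mono' measurableSet_Ioc fun s hs => hle s hs.1.le).trans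
      (lintegral_mono_set fun s hs => hs.1.le)
  have := ENNReal.toReal_mono hg hmono
  have hneg : 0 ≤ (∫⁻ s in Ioc 0 t, ENNReal.ofReal (-f' s)).toReal := ENNReal.toReal_nonneg
  linarith

/-- A sublevel set of a positive definite binary quadratic form is bounded. -/
lemma le_of_quadratic_form_le {A C B a b : ℝ} (hC : 0 < C) (hAC : 1 < A * C)
    (h : A * a ^ 2 - 2 * (a * b) + C * b ^ 2 ≤ B) : a ≤ C * B / (A * C - 1) + 1 := by
  have h0 : 0 < A * C - 1 := by linarith
  have h1 : a ^ 2 ≤ C * B / (A * C - 1) := by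
    rw [le_div_iff₀ h0]
    nlinarith [sq_nonneg (C * b - a), mul_le_mul_of_nonneg_left h hC.le]
  nlinarith [sq_nonneg (a - 1)]

theorem stmt3 {H : Type*} [NormedAddCommGroup H] [InnerProductSpace ℝ H] [CompleteSpace H]
    (φ ψ : H → ℝ) (γ k : ℝ) (β β' : ℝ → ℝ) (x x' x'' : ℝ → H)
    -- ψ is convex, Fréchet differentiable with Lipschitz continuous gradient,
    -- nonnegative, and argmin ψ = ψ⁻¹(0) is nonempty
    (hψconv : ConvexOn ℝ univ ψ)
    (hψdiff : Differentiable ℝ ψ)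
    (hψlip : ∃ L : NNReal, LipschitzWith L (gradient ψ))
    (hψnonneg : ∀ y, 0 ≤ ψ y)
    (hψmin : ∃ y, ψ y = 0)
    -- φ is convex, Fréchet differentiable with Lipschitz continuous gradient,
    -- bounded from below, and S = {z ∈ argmin ψ : φ z ≤ φ y ∀ y ∈ argmin ψ} is nonempty
    (hφconv : ConvexOn ℝ univ φ)
    (hφdiff : Differentiable ℝ φ)
    (hφlip : ∃ L : NNReal, LipschitzWith L (gradient φ))
    (hφbdd : BddBelow (range φ))
    (hS : ∃ z : H, ψ z = 0 ∧ ∀ y, ψ y = 0 → φ z ≤ φ y)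
    -- γ > 0, 0 ≤ k < γ, and β : [0,∞) → (0,∞) is a C¹ function (with derivative β')
    -- satisfying the growth condition 0 ≤ β' ≤ k β
    (hγ : 0 < γ) (hk : 0 ≤ k) (hkγ : k < γ)
    (hβpos : ∀ t ∈ Ici (0 : ℝ), 0 < β t)
    (hβderiv : ∀ t ∈ Ici (0 : ℝ), HasDerivWithinAt β (β' t) (Ici 0) t)
    (hβ'cont : ContinuousOn β' (Ici 0))
    (hβgrowth : ∀ t ∈ Ici (0 : ℝ), 0 ≤ β' t ∧ β' t ≤ k * β t)
    -- condition (H): for every p in the range of the normal cone to argmin ψ (i.e.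
    -- p ∈ N(z) for some z ∈ argmin ψ = ψ⁻¹(0)), the integral
    -- ∫_0^∞ β(t) [ψ*(p/β(t)) - σ(p/β(t))] dt is finite; here σ(p/β(t)) = ⟪p/β(t), z⟫
    -- since p ∈ N(z), and β(t)[ψ*(q) - ⟪q, z⟫] = ⨆ w, β(t)((⟪q, w⟫ - ψ w) - ⟪q, z⟫) ≥ 0.
    (hH : ∀ z p : H, ψ z = 0 → (∀ y, ψ y = 0 → ⟪p, y - z⟫ ≤ 0) →
      ∫⁻ t in Ici (0 : ℝ), ⨆ w : H,
        ENNReal.ofReal (β t * ((⟪(β t)⁻¹ • p, w⟫ - ψ w) - ⟪(β t)⁻¹ • p, z⟫)) ≠ ⊤)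
    -- x : [0,∞) → H is twice continuously differentiable (first derivative x',
    -- second derivative x'') and satisfies ẍ + γ ẋ + ∇φ(x) + β ∇ψ(x) = 0 on [0,∞)
    (hx' : ∀ t ∈ Ici (0 : ℝ), HasDerivWithinAt x (x' t) (Ici 0) t)
    (hx'' : ∀ t ∈ Ici (0 : ℝ), HasDerivWithinAt x' (x'' t) (Ici 0) t)
    (hx''cont : ContinuousOn x'' (Ici 0))
    (hode : ∀ t ∈ Ici (0 : ℝ),
      x'' t + γ • x' t + gradient φ (x t) + β t • gradient ψ (x t) = 0) :
    (∃ M : ℝ, ∀ t ∈ Ici (0 : ℝ), ‖x t‖ ≤ M) ∧ (∃ M : ℝ, ∀ t ∈ Ici (0 : ℝ), ‖x' t‖ ≤ M) := by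
  obtain ⟨z, hz0, hzmin⟩ := hS
  obtain ⟨m, hm⟩ := hφbdd
  have hγk : 0 < γ + k := by linarith
  set l : ℝ := 2 / (γ + k) with hl
  have hl0 : 0 < l := by positivity
  have hlγ : 1 < l * γ := by rw [hl, div_mul_eq_mul_div, lt_div_iff₀ hγk]; linarith
  have hlk : l * k < 1 := by rw [hl, div_mul_eq_mul_div, div_lt_one hγk]; linarith
  set c : ℝ := 1 - l * k with hc
  have hc0 : 0 < c := by linarith
  have hnormal : ∀ y, ψ y = 0 → ⟪-(c⁻¹ • gradient φ z), y - z⟫ ≤ 0 := by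
    intro y hy
    have hs : Convex ℝ {w | w ∈ univ ∧ ψ w ≤ 0} := hψconv.convex_le 0
    have hmin : IsMinOn φ {w | w ∈ univ ∧ ψ w ≤ 0} z :=
      isMinOn_iff.2 fun w hw => hzmin w (le_antisymm hw.2 (hψnonneg w))
    have := hmin.inner_gradient_sub_nonneg hs (hφdiff z) ⟨mem_univ _, hz0.le⟩
      (b := y) ⟨mem_univ _, hy.le⟩
    rw [inner_neg_left, real_inner_smul_left]
    have := mul_nonneg (inv_pos.2 hc0).le this
    linarith
  have hfin := hH z (-(c⁻¹ • gradient φ z)) hz0 hnormal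
  have hcomp : ∀ f : H → ℝ, Differentiable ℝ f → ∀ t ∈ Ici (0 : ℝ),
      HasDerivWithinAt (fun s => f (x s)) ⟪gradient f (x t), x' t⟫ (Ici 0) t := by
    intro f hf t ht
    rw [inner_gradient_left]
    exact (hf (x t)).hasFDerivAt.comp_hasDerivWithinAt t (hx' t ht)
  have hxc : ContinuousOn x (Ici 0) := fun t ht => (hx' t ht).continuousWithinAt
  have hx'c : ContinuousOn x' (Ici 0) := fun t ht => (hx'' t ht).continuousWithinAt
  -- The Lyapunov function, divided by `c`, and its derivative.
  let F : ℝ → ℝ := fun t => c⁻¹ * (l * (2⁻¹ * ⟪x' t, x' t⟫ + (φ (x t) + β t * ψ (x t))) +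
    (⟪x' t, x t - z⟫ + γ / 2 * ⟪x t - z, x t - z⟫))
  let F' : ℝ → ℝ := fun t => c⁻¹ * (l * (-γ * ⟪x' t, x' t⟫ + β' t * ψ (x t)) +
    (⟪x'' t, x t - z⟫ + ⟪x' t, x' t⟫ + γ * ⟪x' t, x t - z⟫))
  have hF : ∀ t ∈ Ici (0 : ℝ), HasDerivWithinAt F (F' t) (Ici 0) t := by
    intro t ht
    have hv := (hx' t ht).sub_const z
    have h := ((((((hx'' t ht).inner ℝ (hx'' t ht)).const_mul (2⁻¹ : ℝ)).add
      ((hcomp φ hφdiff t ht).add ((hβderiv t ht).mul (hcomp ψ hψdiff t ht)))).const_mul l).add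
      (((hx'' t ht).inner ℝ hv).add ((hv.inner ℝ hv).const_mul (γ / 2)))).const_mul c⁻¹
    refine h.congr_deriv ?_
    have hinner := congrArg (fun w => ⟪w, x' t⟫) (hode t ht)
    simp only [inner_add_left, real_inner_smul_left, inner_zero_left] at hinner
    simp only [F']
    rw [real_inner_comm (x'' t) (x' t), real_inner_comm (x' t) (x t - z)]
    linear_combination c⁻¹ * l * hinner
  have hF'c : ContinuousOn F' (Ici 0) := by
    have hψc : ContinuousOn (fun t => ψ (x t)) (Ici 0) := hψdiff.continuous.comp_continuousOn hxc
    have hv : ContinuousOn (fun t => x t - z) (Ici 0) := hxc.sub continuousOn_const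
    exact continuousOn_const.mul ((continuousOn_const.mul ((continuousOn_const.mul
      (hx'c.inner hx'c)).add (hβ'cont.mul hψc))).add (((hx''cont.inner hv).add
      (hx'c.inner hx'c)).add (continuousOn_const.mul (hx'c.inner hv))))
  have hle : ∀ t ∈ Ici (0 : ℝ),
      F' t ≤ β t * ((⟪(β t)⁻¹ • (-(c⁻¹ • gradient φ z)), x t⟫ - ψ (x t)) -
        ⟪(β t)⁻¹ • (-(c⁻¹ • gradient φ z)), z⟫) := by
    intro t ht
    have hβ := hβpos t ht
    have hrhs : β t * ((⟪(β t)⁻¹ • (-(c⁻¹ • gradient φ z)), x t⟫ - ψ (x t)) -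
        ⟪(β t)⁻¹ • (-(c⁻¹ • gradient φ z)), z⟫) =
        c⁻¹ * (-⟪gradient φ z, x t - z⟫ - c * (β t * ψ (x t))) := by
      simp only [real_inner_smul_left, inner_neg_left, inner_sub_right]
      field_simp
      ring
    rw [hrhs]
    refine mul_le_mul_of_nonneg_left ?_ (inv_pos.2 hc0).le
    have h1 := hφconv.inner_gradient_le_sub (hφdiff (x t)) z
    have h2 := hφconv.inner_gradient_le_sub (hφdiff z) (x t)
    have h3 := mul_le_mul_of_nonneg_left
      (hψconv.inner_gradient_le_sub (hψdiff (x t)) z) hβ.le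
    have h4 := mul_le_mul_of_nonneg_left
      (mul_le_mul_of_nonneg_right (hβgrowth t ht).2 (hψnonneg (x t))) hl0.le
    have h5 : 0 ≤ (l * γ - 1) * ⟪x' t, x' t⟫ :=
      mul_nonneg (by linarith) real_inner_self_nonneg
    have hinner := congrArg (fun w => ⟪w, x t - z⟫) (hode t ht)
    simp only [inner_add_left, real_inner_smul_left, inner_zero_left] at hinner
    rw [← neg_sub (x t) z, inner_neg_right] at h1 h3
    rw [hz0] at h3
    rw [hc]
    linarith
  obtain ⟨M, hM⟩ := exists_forall_le_of_ofReal_deriv_le hF hF'c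
    (fun t ht => (ENNReal.ofReal_le_ofReal (hle t ht)).trans
      (le_iSup (fun w => ENNReal.ofReal (β t * ((⟪(β t)⁻¹ • (-(c⁻¹ • gradient φ z)), w⟫ - ψ w) -
        ⟪(β t)⁻¹ • (-(c⁻¹ • gradient φ z)), z⟫))) (x t))) hfin
  have hquad : ∀ t ∈ Ici (0 : ℝ),
      l * ‖x' t‖ ^ 2 - 2 * (‖x' t‖ * ‖x t - z‖) + γ * ‖x t - z‖ ^ 2 ≤ 2 * (c * M - l * m) := by
    intro t ht
    have h1 : c * F t ≤ c * M := mul_le_mul_of_nonneg_left (hM t ht) hc0.le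
    simp only [F, mul_inv_cancel_left₀ hc0.ne', real_inner_self_eq_norm_sq] at h1
    have h2 : l * m ≤ l * φ (x t) := mul_le_mul_of_nonneg_left (hm ⟨x t, rfl⟩) hl0.le
    have h3 : 0 ≤ l * (β t * ψ (x t)) :=
      mul_nonneg hl0.le (mul_nonneg (hβpos t ht).le (hψnonneg _))
    have h4 := (abs_le.1 (abs_real_inner_le_norm (x' t) (x t - z))).1
    linarith
  constructor
  · refine ⟨l * (2 * (c * M - l * m)) / (γ * l - 1) + 1 + ‖z‖, fun t ht => ?_⟩
    have h1 := le_of_quadratic_form_le (A := γ) (B := 2 * (c * M - l * m)) (a := ‖x t - z‖) (b := ‖x' t‖) hl0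
      (by linarith) (by linarith [hquad t ht])
    have h2 : ‖x t‖ ≤ ‖x t - z‖ + ‖z‖ := by
      simpa using norm_add_le (x t - z) z
    linarith
  · exact ⟨_, fun t ht => le_of_quadratic_form_le hγ hlγ (hquad t ht)⟩
end

section
/- Under the stated hypotheses, ∫_0^∞ β(t) ψ(x(t)) dt < +∞. -/
open Filter MeasureTheory Set RealInnerProductSpace

/-- A differentiable convex function lies above its tangent hyperplanes. -/
theorem ConvexOn.add_inner_gradient_le {H : Type*} [NormedAddCommGroup H]
    [InnerProductSpace ℝ H] [CompleteSpace H] {f : H → ℝ} (hf : ConvexOn ℝ univ f)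
    {a : H} (hd : DifferentiableAt ℝ f a) (b : H) :
    f a + ⟪gradient f a, b - a⟫ ≤ f b := by
  have hline : HasDerivAt (fun s : ℝ => f (AffineMap.lineMap a b s))
      ⟪gradient f a, b - a⟫ 0 := by
    have h1 : HasFDerivAt f (InnerProductSpace.toDual ℝ H (gradient f a))
        (AffineMap.lineMap a b (0 : ℝ)) := by
      simpa using hd.hasGradientAt.hasFDerivAt
    have h2 := h1.comp_hasDerivAt (0 : ℝ) (AffineMap.hasDerivAt_lineMap (a := a) (b := b))
    simpa [InnerProductSpace.toDual_apply_apply] using! h2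
  have hconv : ConvexOn ℝ univ (fun s : ℝ => f (AffineMap.lineMap a b s)) := by
    simpa using! hf.comp_affineMap (AffineMap.lineMap a b : ℝ →ᵃ[ℝ] H)
  have h := hconv.le_slope_of_hasDerivAt (mem_univ 0) (mem_univ 1) zero_lt_one hline
  simp only [slope_def_field, AffineMap.lineMap_apply_one, AffineMap.lineMap_apply_zero,
    sub_zero, div_one] at h
  linarith

/-- First-order optimality condition for minimizing over a convex set. -/
theorem IsMinOn.inner_gradient_nonneg {H : Type*} [NormedAddCommGroup H]
    [InnerProductSpace ℝ H] [CompleteSpace H] {f : H → ℝ} {C : Set H} (hC : Convex ℝ C)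
    {z y : H} (hd : DifferentiableAt ℝ f z) (hmin : IsMinOn f C z) (hz : z ∈ C) (hy : y ∈ C) :
    0 ≤ ⟪gradient f z, y - z⟫ :=
  hmin.localize.hasFDerivWithinAt_nonneg hd.hasGradientAt.hasFDerivAt.hasFDerivWithinAt
    (sub_mem_posTangentConeAt_of_segment_subset (hC.segment_subset hz hy))

/-- If a function `W` bounded below satisfies `W' ≤ g - f` on `(0, ∞)` with `f ≥ 0` continuous
and `g` integrable, then `f` is integrable. -/
theorem integrableOn_Ici_of_hasDerivWithinAt_le_sub {W W' f g : ℝ → ℝ} {m : ℝ}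
    (hW : ∀ t ∈ Ici (0 : ℝ), HasDerivWithinAt W (W' t) (Ici 0) t)
    (hm : ∀ t ∈ Ici (0 : ℝ), m ≤ W t)
    (hf : ContinuousOn f (Ici 0)) (hf0 : ∀ t ∈ Ici (0 : ℝ), 0 ≤ f t)
    (hg : IntegrableOn g (Ici 0)) (hg0 : ∀ t, 0 ≤ g t)
    (hle : ∀ t ∈ Ici (0 : ℝ), W' t ≤ g t - f t) :
    IntegrableOn f (Ici 0) := by
  have hfi (T : ℝ) : IntegrableOn f (Icc 0 T) :=
    (hf.mono Icc_subset_Ici_self).integrableOn_Icc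
  rw [integrableOn_Ici_iff_integrableOn_Ioi]
  refine integrableOn_Ioi_of_intervalIntegral_norm_bounded (l := atTop) (b := id)
    (W 0 - m + ∫ t in Ici 0, g t) 0 (fun T => (hfi T).mono_set Ioc_subset_Icc_self)
    tendsto_id ?_
  filter_upwards [eventually_ge_atTop (0 : ℝ)] with T hT
  have hgi : IntegrableOn g (Icc 0 T) := hg.mono_set Icc_subset_Ici_self
  have key : W T - W 0 ≤ ∫ t in (0 : ℝ)..T, (g t - f t) := by
    refine intervalIntegral.sub_le_integral_of_hasDeriv_right_of_le (g' := W') hT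
      (fun t ht => ((hW t ht.1).continuousWithinAt).mono Icc_subset_Ici_self)
      (fun t ht => (hW t ht.1.le).mono (Ioi_subset_Ici ht.1.le)) (hgi.sub (hfi T))
      (fun t ht => hle t ht.1.le)
  have hsub : ∫ t in (0 : ℝ)..T, (g t - f t)
      = (∫ t in (0 : ℝ)..T, g t) - ∫ t in (0 : ℝ)..T, f t :=
    intervalIntegral.integral_sub
      ((intervalIntegrable_iff_integrableOn_Icc_of_le hT).2 hgi)
      ((intervalIntegrable_iff_integrableOn_Icc_of_le hT).2 (hfi T))
  have hgle : ∫ t in (0 : ℝ)..T, g t ≤ ∫ t in Ici 0, g t := by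
    rw [intervalIntegral.integral_of_le hT]
    exact setIntegral_mono_set hg (Eventually.of_forall hg0)
      (Ioc_subset_Icc_self.trans Icc_subset_Ici_self).eventuallyLE
  have hnorm : ∫ t in (0 : ℝ)..T, ‖f t‖ = ∫ t in (0 : ℝ)..T, f t := by
    refine intervalIntegral.integral_congr fun t ht => ?_
    rw [uIcc_of_le hT] at ht
    exact Real.norm_of_nonneg (hf0 t ht.1)
  have := hm T hT
  simp only [id]
  linarith

theorem stmt4 {H : Type*} [NormedAddCommGroup H] [InnerProductSpace ℝ H] [CompleteSpace H]
    (φ ψ : H → ℝ) (γ k : ℝ) (β β' : ℝ → ℝ) (x x' x'' : ℝ → H)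
    -- ψ is convex, Fréchet differentiable with Lipschitz continuous gradient,
    -- nonnegative, and argmin ψ = ψ⁻¹(0) is nonempty
    (hψconv : ConvexOn ℝ univ ψ)
    (hψdiff : Differentiable ℝ ψ)
    (hψlip : ∃ L : NNReal, LipschitzWith L (gradient ψ))
    (hψnonneg : ∀ y, 0 ≤ ψ y)
    (hψmin : ∃ y, ψ y = 0)
    -- φ is convex, Fréchet differentiable with Lipschitz continuous gradient,
    -- bounded from below, and S = {z ∈ argmin ψ : φ z ≤ φ y ∀ y ∈ argmin ψ} is nonempty
    (hφconv : ConvexOn ℝ univ φ)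
    (hφdiff : Differentiable ℝ φ)
    (hφlip : ∃ L : NNReal, LipschitzWith L (gradient φ))
    (hφbdd : BddBelow (range φ))
    (hS : ∃ z : H, ψ z = 0 ∧ ∀ y, ψ y = 0 → φ z ≤ φ y)
    -- γ > 0, 0 ≤ k < γ, and β : [0,∞) → (0,∞) is a C¹ function (with derivative β')
    -- satisfying the growth condition 0 ≤ β' ≤ k β
    (hγ : 0 < γ) (hk : 0 ≤ k) (hkγ : k < γ)
    (hβpos : ∀ t ∈ Ici (0 : ℝ), 0 < β t)
    (hβderiv : ∀ t ∈ Ici (0 : ℝ), HasDerivWithinAt β (β' t) (Ici 0) t)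
    (hβ'cont : ContinuousOn β' (Ici 0))
    (hβgrowth : ∀ t ∈ Ici (0 : ℝ), 0 ≤ β' t ∧ β' t ≤ k * β t)
    -- condition (H): for every p in the range of the normal cone to argmin ψ (i.e.
    -- p ∈ N(z) for some z ∈ argmin ψ = ψ⁻¹(0)), the integral
    -- ∫_0^∞ β(t) [ψ*(p/β(t)) - σ(p/β(t))] dt is finite; here σ(p/β(t)) = ⟪p/β(t), z⟫
    -- since p ∈ N(z), and β(t)[ψ*(q) - ⟪q, z⟫] = ⨆ w, β(t)((⟪q, w⟫ - ψ w) - ⟪q, z⟫) ≥ 0.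
    (hH : ∀ z p : H, ψ z = 0 → (∀ y, ψ y = 0 → ⟪p, y - z⟫ ≤ 0) →
      ∫⁻ t in Ici (0 : ℝ), ⨆ w : H,
        ENNReal.ofReal (β t * ((⟪(β t)⁻¹ • p, w⟫ - ψ w) - ⟪(β t)⁻¹ • p, z⟫)) ≠ ⊤)
    -- x : [0,∞) → H is twice continuously differentiable (first derivative x',
    -- second derivative x'') and satisfies ẍ + γ ẋ + ∇φ(x) + β ∇ψ(x) = 0 on [0,∞)
    (hx' : ∀ t ∈ Ici (0 : ℝ), HasDerivWithinAt x (x' t) (Ici 0) t)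
    (hx'' : ∀ t ∈ Ici (0 : ℝ), HasDerivWithinAt x' (x'' t) (Ici 0) t)
    (hx''cont : ContinuousOn x'' (Ici 0))
    (hode : ∀ t ∈ Ici (0 : ℝ),
      x'' t + γ • x' t + gradient φ (x t) + β t • gradient ψ (x t) = 0) :
    IntegrableOn (fun t => β t * ψ (x t)) (Ici 0) := by
  obtain ⟨z, hz, hzmin⟩ := hS
  obtain ⟨m, hm⟩ := hφbdd
  have hφm (y : H) : m ≤ φ y := hm (mem_range_self y)
  have hC : Convex ℝ {y | ψ y = 0} := by
    have h := hψconv.convex_le 0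
    have heq : {y | ψ y = 0} = {y ∈ univ | ψ y ≤ 0} := by
      ext y
      simpa using ⟨fun h => h.le, fun h => le_antisymm h (hψnonneg y)⟩
    rwa [heq]
  have hopt (y : H) (hy : ψ y = 0) : 0 ≤ ⟪gradient φ z, y - z⟫ :=
    IsMinOn.inner_gradient_nonneg hC (hφdiff z) hzmin hz hy
  set c := (γ + k) / 2 with hc
  set δ := (c - k) / 2 with hδ
  have hcpos : 0 < c := by linarith
  have hcγ : c < γ := by linarith
  have hδpos : 0 < δ := by linarith
  have hxc : ContinuousOn x (Ici 0) := fun t ht => (hx' t ht).continuousWithinAt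
  have hβc : ContinuousOn β (Ici 0) := fun t ht => (hβderiv t ht).continuousWithinAt
  have hf : ContinuousOn (fun t => β t * ψ (x t)) (Ici 0) :=
    hβc.mul (hψdiff.continuous.comp_continuousOn hxc)
  have hf0 : ∀ t ∈ Ici (0 : ℝ), 0 ≤ β t * ψ (x t) := fun t ht =>
    mul_nonneg (hβpos t ht).le (hψnonneg _)
  set q : H := -((c / δ) • gradient φ z) with hq
  have hqN (y : H) (hy : ψ y = 0) : ⟪q, y - z⟫ ≤ 0 := by
    rw [hq, inner_neg_left, real_inner_smul_left, neg_nonpos]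
    exact mul_nonneg (by positivity) (hopt y hy)
  set g : ℝ → ℝ := fun t => max (⟪q, x t - z⟫ - β t * ψ (x t)) 0 with hg
  have hg0 (t : ℝ) : 0 ≤ g t := le_max_right _ _
  have hgc : ContinuousOn g (Ici 0) :=
    ((continuousOn_const.inner (hxc.sub continuousOn_const)).sub hf).sup continuousOn_const
  have hgint : IntegrableOn g (Ici 0) := by
    refine ⟨hgc.aestronglyMeasurable measurableSet_Ici, ?_⟩
    rw [hasFiniteIntegral_iff_ofReal (Eventually.of_forall hg0)]
    refine lt_of_le_of_lt (setLIntegral_mono' measurableSet_Ici fun t ht => ?_)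
      (hH z q hz hqN).lt_top
    refine le_iSup_of_le (x t) (le_of_eq ?_)
    have hβ := (hβpos t ht).ne'
    have h : β t * ((⟪(β t)⁻¹ • q, x t⟫ - ψ (x t)) - ⟪(β t)⁻¹ • q, z⟫)
        = ⟪q, x t - z⟫ - β t * ψ (x t) := by
      rw [real_inner_smul_left, real_inner_smul_left, inner_sub_right]
      field_simp
      ring
    rw [h, hg]
    simp [ENNReal.ofReal_max]
  have hcomp {f : H → ℝ} (hfd : Differentiable ℝ f) {t : ℝ} (ht : t ∈ Ici (0 : ℝ)) :
      HasDerivWithinAt (fun s => f (x s)) ⟪gradient f (x t), x' t⟫ (Ici 0) t := by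
    simpa [InnerProductSpace.toDual_apply_apply] using!
      (hfd (x t)).hasGradientAt.hasFDerivAt.comp_hasDerivWithinAt t (hx' t ht)
  have hsub (t : ℝ) (ht : t ∈ Ici (0 : ℝ)) :
      HasDerivWithinAt (fun s => x s - z) (x' t) (Ici 0) t := (hx' t ht).sub_const z
  have main : IntegrableOn (fun t => δ * (β t * ψ (x t))) (Ici 0) := by
    refine integrableOn_Ici_of_hasDerivWithinAt_le_sub (g := fun t => δ * g t) (m := m)
      (W := fun t => 1 / 2 * ⟪x' t, x' t⟫ + φ (x t) + β t * ψ (x t) + c * ⟪x' t, x t - z⟫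
        + c * γ / 2 * ⟪x t - z, x t - z⟫)
      (fun t ht => ((((((hx'' t ht).inner ℝ (hx'' t ht)).const_mul (1 / 2)).add
        (hcomp hφdiff ht)).add ((hβderiv t ht).mul (hcomp hψdiff ht))).add
        (((hx'' t ht).inner ℝ (hsub t ht)).const_mul c)).add
        (((hsub t ht).inner ℝ (hsub t ht)).const_mul (c * γ / 2)))
      (fun t ht => ?_) (hf.const_mul δ) (fun t ht => mul_nonneg hδpos.le (hf0 t ht))
      (hgint.const_mul δ) (fun t => mul_nonneg hδpos.le (hg0 t)) (fun t ht => ?_)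
    · have h1 : 0 ≤ ⟪x' t + c • (x t - z), x' t + c • (x t - z)⟫ := real_inner_self_nonneg
      rw [real_inner_add_add_self, real_inner_smul_right, real_inner_smul_left,
        real_inner_smul_right] at h1
      have h2 : 0 ≤ c * (γ - c) * ⟪x t - z, x t - z⟫ :=
        mul_nonneg (mul_nonneg hcpos.le (by linarith)) real_inner_self_nonneg
      have := hφm (x t)
      have := hf0 t ht
      linarith
    · have hode' : x'' t = -(γ • x' t + gradient φ (x t) + β t • gradient ψ (x t)) := by
        have h := hode t ht
        rw [add_assoc, add_assoc] at h
        rw [eq_neg_of_add_eq_zero_left h, add_assoc]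
      have e1 : ⟪x'' t, x' t⟫ = -(γ * ⟪x' t, x' t⟫ + ⟪gradient φ (x t), x' t⟫
          + β t * ⟪gradient ψ (x t), x' t⟫) := by
        rw [hode', inner_neg_left, inner_add_left, inner_add_left, real_inner_smul_left,
          real_inner_smul_left]
      have e2 : ⟪x'' t, x t - z⟫ = -(γ * ⟪x' t, x t - z⟫ + ⟪gradient φ (x t), x t - z⟫
          + β t * ⟪gradient ψ (x t), x t - z⟫) := by
        rw [hode', inner_neg_left, inner_add_left, inner_add_left, real_inner_smul_left,
          real_inner_smul_left]
      have i1 : φ (x t) - φ z ≤ ⟪gradient φ (x t), x t - z⟫ := by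
        have h := hφconv.add_inner_gradient_le (hφdiff (x t)) z
        rw [← neg_sub (x t) z, inner_neg_right] at h
        linarith
      have i2 : ψ (x t) ≤ ⟪gradient ψ (x t), x t - z⟫ := by
        have h := hψconv.add_inner_gradient_le (hψdiff (x t)) z
        rw [← neg_sub (x t) z, inner_neg_right, hz] at h
        linarith
      have i3 := hφconv.add_inner_gradient_le (hφdiff z) (x t)
      have i4 : δ * (⟪q, x t - z⟫ - β t * ψ (x t)) ≤ δ * g t :=
        mul_le_mul_of_nonneg_left (le_max_left _ _) hδpos.le
      have e3 : δ * ⟪q, x t - z⟫ = -(c * ⟪gradient φ z, x t - z⟫) := by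
        rw [hq, inner_neg_left, real_inner_smul_left]
        field_simp
      have i5 : β' t * ψ (x t) ≤ k * (β t * ψ (x t)) := by
        rw [← mul_assoc]
        exact mul_le_mul_of_nonneg_right (hβgrowth t ht).2 (hψnonneg _)
      have i6 : c * (β t * ψ (x t)) ≤ c * (β t * ⟪gradient ψ (x t), x t - z⟫) :=
        mul_le_mul_of_nonneg_left (mul_le_mul_of_nonneg_left i2 (hβpos t ht).le) hcpos.le
      have i7 : c * ⟪gradient φ z, x t - z⟫ ≤ c * ⟪gradient φ (x t), x t - z⟫ :=
        mul_le_mul_of_nonneg_left (by linarith) hcpos.le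
      have i8 : 0 ≤ (γ - c) * ⟪x' t, x' t⟫ :=
        mul_nonneg (by linarith) real_inner_self_nonneg
      have e4 : 2 * δ * (β t * ψ (x t)) = (c - k) * (β t * ψ (x t)) := by rw [hδ]; ring
      rw [real_inner_comm (x'' t) (x' t), real_inner_comm (x' t) (x t - z), e1, e2]
      linarith
  simpa [IntegrableOn, inv_mul_cancel_left₀ hδpos.ne'] using main.const_mul δ⁻¹
end

section
/- Under the stated hypotheses, and assuming additionally that β(t) → +∞ as t → +∞, the velocity vanishes asymptotically: lim_{t→∞} ẋ(t) = 0 in norm. -/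
open Filter MeasureTheory Set RealInnerProductSpace

lemma antitoneOn_Ici_of_hasDerivAt_nonpos {f f' : ℝ → ℝ} {a : ℝ} (hc : ContinuousOn f (Ici a))
    (hd : ∀ t, a < t → HasDerivAt f (f' t) t) (hf' : ∀ t, a < t → f' t ≤ 0) :
    AntitoneOn f (Ici a) := by
  refine antitoneOn_of_deriv_nonpos (convex_Ici a) hc ?_ ?_ <;> rw [interior_Ici]
  · exact fun t ht => (hd t ht).differentiableAt.differentiableWithinAt
  · intro t ht
    rw [(hd t ht).deriv]
    exact hf' t ht

lemma exists_antiderivative_on_Ici {f : ℝ → ℝ} (hf : ContinuousOn f (Ici 0)) :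
    ∃ F : ℝ → ℝ, F 0 = 0 ∧ ContinuousOn F (Ici 0) ∧ (∀ t, 0 < t → HasDerivAt F (f t) t) ∧
      ((∀ t, 0 ≤ t → 0 ≤ f t) → ∫⁻ t in Ici (0 : ℝ), ENNReal.ofReal (f t) ≠ ⊤ →
        ∃ B, ∀ t, 0 ≤ t → F t ≤ B) := by
  have hg : Continuous fun t => f (max t 0) :=
    hf.comp_continuous (by fun_prop) fun t => le_max_right t 0
  have hderiv : ∀ t, HasDerivAt (fun t => ∫ s in (0 : ℝ)..t, f (max s 0)) (f (max t 0)) t :=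
    fun t => intervalIntegral.integral_hasDerivAt_right (hg.intervalIntegrable _ _)
      (hg.stronglyMeasurableAtFilter _ _) hg.continuousAt
  refine ⟨fun t => ∫ s in (0 : ℝ)..t, f (max s 0), by simp,
    fun t _ => (hderiv t).continuousAt.continuousWithinAt, fun t ht => ?_, fun h0 hfin => ?_⟩
  · simpa [max_eq_left ht.le] using hderiv t
  · refine ⟨(∫⁻ t in Ici (0 : ℝ), ENNReal.ofReal (f t)).toReal, fun t ht => ?_⟩
    beta_reduce
    rw [intervalIntegral.integral_of_le ht, integral_eq_lintegral_of_nonneg_ae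
      (Eventually.of_forall fun s => h0 _ (le_max_right s 0)) hg.aestronglyMeasurable]
    refine ENNReal.toReal_mono hfin ?_
    calc ∫⁻ s in Ioc 0 t, ENNReal.ofReal (f (max s 0))
        = ∫⁻ s in Ioc 0 t, ENNReal.ofReal (f s) :=
          setLIntegral_congr_fun measurableSet_Ioc fun s hs => by simp [max_eq_left hs.1.le]
      _ ≤ _ := lintegral_mono_set fun s hs => hs.1.le

lemma eventually_le_of_antitoneOn_sub_of_antiderivative_le {e Q R : ℝ → ℝ} {k B K : ℝ}
    (hk : 0 ≤ k) (hanti : AntitoneOn (fun t => e t - k * Q t) (Ici 0))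
    (hQ : MonotoneOn Q (Ici 0)) (hQB : ∀ t, 0 ≤ t → Q t ≤ B)
    (hRc : ContinuousOn R (Ici 0)) (hRd : ∀ t, 0 < t → HasDerivAt R (e t) t)
    (hRK : ∀ t, 0 ≤ t → R t ≤ K) {ε : ℝ} (hε : 0 < ε) : ∀ᶠ t in atTop, e t ≤ ε := by
  have hbdd : BddAbove (Q '' Ici 0) := ⟨B, by rintro _ ⟨t, ht, rfl⟩; exact hQB t ht⟩
  have hη : 0 < ε / 2 / (k + 1) := by positivity
  obtain ⟨_, ⟨s₀, hs₀, rfl⟩, hQs₀⟩ := exists_lt_of_lt_csSup (s := Q '' Ici 0)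
    ⟨Q 0, 0, self_mem_Ici, rfl⟩ (sub_lt_self _ hη)
  obtain ⟨s, hs₀s, hes⟩ : ∃ s, s₀ < s ∧ e s ≤ ε / 2 := by
    by_contra! hcon
    have hs₀' : Ici s₀ ⊆ Ici (0 : ℝ) := Ici_subset_Ici.2 hs₀
    have hmono : AntitoneOn (fun t => ε / 2 * t - R t) (Ici s₀) := by
      refine antitoneOn_Ici_of_hasDerivAt_nonpos (f' := fun t => ε / 2 - e t)
        ((continuousOn_const.mul continuousOn_id).sub (hRc.mono hs₀')) (fun t ht => ?_)
        fun t ht => sub_nonpos.2 (hcon t ht).le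
      exact ((hasDerivAt_id t).const_mul (ε / 2)).sub (hRd t (lt_of_le_of_lt hs₀ ht)) |>.congr_deriv
        (by rw [mul_one])
    set T := max s₀ ((K + 1 + (ε / 2 * s₀ - R s₀)) / (ε / 2)) with hT
    have h1 := hmono self_mem_Ici (mem_Ici.2 (le_max_left _ _) : T ∈ Ici s₀) (le_max_left _ _)
    have h2 := hRK T (hs₀.trans (le_max_left _ _))
    have h3 : (K + 1 + (ε / 2 * s₀ - R s₀)) / (ε / 2) ≤ T := le_max_right _ _
    rw [div_le_iff₀ (by positivity)] at h3
    simp only at h1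
    linarith
  have hs : 0 ≤ s := (mem_Ici.1 hs₀).trans hs₀s.le
  filter_upwards [eventually_ge_atTop s] with t ht
  have h1 := hanti (mem_Ici.2 hs) (mem_Ici.2 (hs.trans ht)) ht
  have h2 : Q t ≤ sSup (Q '' Ici 0) := le_csSup hbdd ⟨t, hs.trans ht, rfl⟩
  have h3 := hQ hs₀ (mem_Ici.2 hs) hs₀s.le
  have h4 : k * (Q t - Q s) ≤ k * (ε / 2 / (k + 1)) :=
    mul_le_mul_of_nonneg_left (by linarith) hk
  have h5 : k * (ε / 2 / (k + 1)) ≤ ε / 2 := by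
    rw [mul_div_assoc', div_le_iff₀ (by positivity)]
    nlinarith
  simp only at h1
  linarith

section Gradient

variable {H : Type*} [NormedAddCommGroup H] [InnerProductSpace ℝ H] [CompleteSpace H]

lemma hasDerivAt_comp_gradient {φ : H → ℝ} (hφ : Differentiable ℝ φ) {x : ℝ → H} {v : H} {t : ℝ}
    (hx : HasDerivAt x v t) : HasDerivAt (fun s => φ (x s)) ⟪gradient φ (x t), v⟫ t :=
  (hφ (x t)).hasGradientAt.hasFDerivAt.comp_hasDerivAt t hx

lemma ConvexOn.add_inner_gradient_le_s11 {φ : H → ℝ} (hc : ConvexOn ℝ univ φ)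
    (hφ : Differentiable ℝ φ) (x y : H) : φ x + ⟪gradient φ x, y - x⟫ ≤ φ y := by
  have hline : HasDerivAt (AffineMap.lineMap x y : ℝ → H) (y - x) 0 :=
    AffineMap.hasDerivAt_lineMap
  have hd := hasDerivAt_comp_gradient hφ hline
  have hconv : ConvexOn ℝ univ fun s : ℝ => φ (AffineMap.lineMap x y s) :=
    hc.comp_affineMap (AffineMap.lineMap x y : ℝ →ᵃ[ℝ] H)
  have h := hconv.le_slope_of_hasDerivAt (mem_univ _) (mem_univ _) zero_lt_one hd
  simp only [slope, AffineMap.lineMap_apply_zero, AffineMap.lineMap_apply_one, sub_zero, inv_one,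
    one_smul, vsub_eq_sub] at h
  linarith

lemma inner_gradient_nonneg_of_isMinOn {φ : H → ℝ} (hφ : Differentiable ℝ φ) {s : Set H}
    (hs : Convex ℝ s) {z y : H} (hz : z ∈ s) (hy : y ∈ s) (hmin : IsMinOn φ s z) :
    0 ≤ ⟪gradient φ z, y - z⟫ := by
  have h := hmin.localize.hasFDerivWithinAt_nonneg
    (hφ z).hasGradientAt.hasFDerivAt.hasFDerivWithinAt
    (sub_mem_posTangentConeAt_of_segment_subset (hs.segment_subset hz hy))
  simpa using h

end Gradient

theorem stmt11 {H : Type*} [NormedAddCommGroup H] [InnerProductSpace ℝ H] [CompleteSpace H]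
    (φ ψ : H → ℝ) (γ k : ℝ) (β β' : ℝ → ℝ) (x x' x'' : ℝ → H)
    -- ψ is convex, Fréchet differentiable with Lipschitz continuous gradient,
    -- nonnegative, and argmin ψ = ψ⁻¹(0) is nonempty
    (hψconv : ConvexOn ℝ univ ψ)
    (hψdiff : Differentiable ℝ ψ)
    (hψlip : ∃ L : NNReal, LipschitzWith L (gradient ψ))
    (hψnonneg : ∀ y, 0 ≤ ψ y)
    (hψmin : ∃ y, ψ y = 0)
    -- φ is convex, Fréchet differentiable with Lipschitz continuous gradient,
    -- bounded from below, and S = {z ∈ argmin ψ : φ z ≤ φ y ∀ y ∈ argmin ψ} is nonempty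
    (hφconv : ConvexOn ℝ univ φ)
    (hφdiff : Differentiable ℝ φ)
    (hφlip : ∃ L : NNReal, LipschitzWith L (gradient φ))
    (hφbdd : BddBelow (range φ))
    (hS : ∃ z : H, ψ z = 0 ∧ ∀ y, ψ y = 0 → φ z ≤ φ y)
    -- γ > 0, 0 ≤ k < γ, and β : [0,∞) → (0,∞) is a C¹ function (with derivative β')
    -- satisfying the growth condition 0 ≤ β' ≤ k β
    (hγ : 0 < γ) (hk : 0 ≤ k) (hkγ : k < γ)
    (hβpos : ∀ t ∈ Ici (0 : ℝ), 0 < β t)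
    (hβderiv : ∀ t ∈ Ici (0 : ℝ), HasDerivWithinAt β (β' t) (Ici 0) t)
    (hβ'cont : ContinuousOn β' (Ici 0))
    (hβgrowth : ∀ t ∈ Ici (0 : ℝ), 0 ≤ β' t ∧ β' t ≤ k * β t)
    -- condition (H): for every p in the range of the normal cone to argmin ψ (i.e.
    -- p ∈ N(z) for some z ∈ argmin ψ = ψ⁻¹(0)), the integral
    -- ∫_0^∞ β(t) [ψ*(p/β(t)) - σ(p/β(t))] dt is finite; here σ(p/β(t)) = ⟪p/β(t), z⟫
    -- since p ∈ N(z), and β(t)[ψ*(q) - ⟪q, z⟫] = ⨆ w, β(t)((⟪q, w⟫ - ψ w) - ⟪q, z⟫) ≥ 0.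
    (hH : ∀ z p : H, ψ z = 0 → (∀ y, ψ y = 0 → ⟪p, y - z⟫ ≤ 0) →
      ∫⁻ t in Ici (0 : ℝ), ⨆ w : H,
        ENNReal.ofReal (β t * ((⟪(β t)⁻¹ • p, w⟫ - ψ w) - ⟪(β t)⁻¹ • p, z⟫)) ≠ ⊤)
    -- x : [0,∞) → H is twice continuously differentiable (first derivative x',
    -- second derivative x'') and satisfies ẍ + γ ẋ + ∇φ(x) + β ∇ψ(x) = 0 on [0,∞)
    (hx' : ∀ t ∈ Ici (0 : ℝ), HasDerivWithinAt x (x' t) (Ici 0) t)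
    (hx'' : ∀ t ∈ Ici (0 : ℝ), HasDerivWithinAt x' (x'' t) (Ici 0) t)
    (hx''cont : ContinuousOn x'' (Ici 0))
    (hode : ∀ t ∈ Ici (0 : ℝ),
      x'' t + γ • x' t + gradient φ (x t) + β t • gradient ψ (x t) = 0)
    -- β(t) → +∞ as t → +∞
    (hβinf : Tendsto β atTop atTop) :
    Tendsto (fun t => ‖x' t‖) atTop (nhds 0) := by
  obtain ⟨z, hz, hzmin⟩ := hS
  obtain ⟨φ₀, hφ₀⟩ := hφbdd
  replace hφ₀ : ∀ y, φ₀ ≤ φ y := fun y => hφ₀ ⟨y, rfl⟩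
  have dx : ∀ t, 0 < t → HasDerivAt x (x' t) t := fun t ht =>
    (hx' t ht.le).hasDerivAt (Ici_mem_nhds ht)
  have dx' : ∀ t, 0 < t → HasDerivAt x' (x'' t) t := fun t ht =>
    (hx'' t ht.le).hasDerivAt (Ici_mem_nhds ht)
  have dβ : ∀ t, 0 < t → HasDerivAt β (β' t) t := fun t ht =>
    (hβderiv t ht.le).hasDerivAt (Ici_mem_nhds ht)
  have cx : ContinuousOn x (Ici 0) := fun t ht => (hx' t ht).continuousWithinAt
  have cx' : ContinuousOn x' (Ici 0) := fun t ht => (hx'' t ht).continuousWithinAt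
  have cβ : ContinuousOn β (Ici 0) := fun t ht => (hβderiv t ht).continuousWithinAt
  have cφ : ContinuousOn (fun t => φ (x t)) (Ici 0) := hφdiff.continuous.comp_continuousOn cx
  have cψ : ContinuousOn (fun t => ψ (x t)) (Ici 0) := hψdiff.continuous.comp_continuousOn cx
  have hβanti : MonotoneOn β (Ici 0) := by
    have h := antitoneOn_Ici_of_hasDerivAt_nonpos cβ.neg (fun t ht => (dβ t ht).neg)
      fun t ht => neg_nonpos.2 (hβgrowth t ht.le).1
    exact fun s hs t ht hst => neg_le_neg_iff.1 (h hs ht hst)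
  -- the optimality condition at `z`, and condition (H) along multiples of `-∇φ(z)`
  have hopt : ∀ y, ψ y = 0 → 0 ≤ ⟪gradient φ z, y - z⟫ := by
    have hset : {y | ψ y = 0} = {y | y ∈ univ ∧ ψ y ≤ 0} := by
      ext y
      simpa using ⟨fun h => h.le, fun h => le_antisymm h (hψnonneg y)⟩
    have hconv : Convex ℝ {y | ψ y = 0} := hset ▸ hψconv.convex_le 0
    exact fun y hy => inner_gradient_nonneg_of_isMinOn hφdiff hconv hz hy fun w hw => hzmin w hw
  have hHfin : ∀ r : ℝ, 0 ≤ r → ∫⁻ t in Ici (0 : ℝ), ⨆ w : H,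
      ENNReal.ofReal (-(r * ⟪gradient φ z, w - z⟫) - β t * ψ w) ≠ ⊤ := by
    intro r hr
    have h := hH z (-(r • gradient φ z)) hz fun y hy => by
      rw [inner_neg_left, real_inner_smul_left]
      exact neg_nonpos.2 (mul_nonneg hr (hopt y hy))
    convert h using 1
    refine setLIntegral_congr_fun measurableSet_Ici fun t ht => iSup_congr fun w => ?_
    have hβ0 := (hβpos t ht).ne'
    congr 1
    simp only [real_inner_smul_left, inner_neg_left, inner_sub_right]
    field_simp
    ring
  -- the energy and the anchor function
  set E : ℝ → ℝ := fun t => 1 / 2 * ‖x' t‖ ^ 2 + φ (x t) + β t * ψ (x t) with hE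
  set D : ℝ → ℝ := fun t => ⟪x t - z, x' t⟫ + γ / 2 * ‖x t - z‖ ^ 2 with hD
  have cE : ContinuousOn E (Ici 0) :=
    ((continuousOn_const.mul (cx'.norm.pow 2)).add cφ).add (cβ.mul cψ)
  have cxz : ContinuousOn (fun t => x t - z) (Ici 0) := cx.sub continuousOn_const
  have cD : ContinuousOn D (Ici 0) :=
    (cxz.inner cx').add (continuousOn_const.mul (cxz.norm.pow 2))
  have hx''eq : ∀ t, 0 < t →
      x'' t = -(γ • x' t) - gradient φ (x t) - β t • gradient ψ (x t) := fun t ht => by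
    rw [← sub_eq_zero, ← hode t ht.le]
    abel
  have dE : ∀ t, 0 < t → HasDerivAt E (-γ * ‖x' t‖ ^ 2 + β' t * ψ (x t)) t := by
    intro t ht
    have h := ((((dx' t ht).norm_sq).const_mul (1 / 2)).add
      (hasDerivAt_comp_gradient hφdiff (dx t ht))).add
      ((dβ t ht).mul (hasDerivAt_comp_gradient hψdiff (dx t ht)))
    refine h.congr_deriv ?_
    rw [hx''eq t ht]
    simp only [inner_sub_right, inner_neg_right, real_inner_smul_right,
      real_inner_self_eq_norm_sq, real_inner_comm (x' t)]
    ring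
  have dD : ∀ t, 0 < t → HasDerivAt D (‖x' t‖ ^ 2 - ⟪gradient φ (x t), x t - z⟫
      - β t * ⟪gradient ψ (x t), x t - z⟫) t := by
    intro t ht
    have hxz := (dx t ht).sub_const z
    have h := (hxz.inner ℝ (dx' t ht)).add (hxz.norm_sq.const_mul (γ / 2))
    refine h.congr_deriv ?_
    rw [hx''eq t ht]
    simp only [inner_sub_right, inner_neg_right, real_inner_smul_right,
      real_inner_self_eq_norm_sq, real_inner_comm (x t - z)]
    ring
  have hφx : ∀ y, φ y - φ z ≤ ⟪gradient φ y, y - z⟫ := fun y => by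
    have h := hφconv.add_inner_gradient_le_s11 hφdiff y z
    rw [← neg_sub y z, inner_neg_right] at h
    linarith
  have hφz : ∀ y, ⟪gradient φ z, y - z⟫ ≤ φ y - φ z := fun y => by
    linarith [hφconv.add_inner_gradient_le_s11 hφdiff z y]
  have hψx : ∀ y, ψ y ≤ ⟪gradient ψ y, y - z⟫ := fun y => by
    have h := hψconv.add_inner_gradient_le_s11 hψdiff y z
    rw [← neg_sub y z, inner_neg_right] at h
    linarith
  have hβψ : ∀ t, 0 ≤ t → 0 ≤ β t * ψ (x t) := fun t ht =>
    mul_nonneg (hβpos t ht).le (hψnonneg _)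
  -- antiderivatives
  set a : ℝ := (k + γ) / 2 with ha
  set c : ℝ := (γ - k) / 4 with hc
  have ha0 : 0 < a := by linarith
  have hc0 : 0 < c := by linarith
  set G : ℝ → ℝ := fun t => -(a / c * ⟪gradient φ z, x t - z⟫) - β t * ψ (x t) with hG
  have cG : ContinuousOn G (Ici 0) :=
    (continuousOn_const.mul (continuousOn_const.inner cxz)).neg.sub (cβ.mul cψ)
  obtain ⟨M, hM0, cM, dM, hMB⟩ := exists_antiderivative_on_Ici
    (f := fun t => max (G t) 0) (cG.sup continuousOn_const)
  obtain ⟨P, hP0, cP, dP, -⟩ := exists_antiderivative_on_Ici (cx'.norm.pow 2)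
  obtain ⟨Q, hQ0, cQ, dQ, -⟩ := exists_antiderivative_on_Ici (cβ.mul cψ)
  obtain ⟨R, hR0, cR, dR, -⟩ := exists_antiderivative_on_Ici (cE.sub (continuousOn_const (c := φ z)))
  obtain ⟨B, hB⟩ := hMB (fun t _ => le_max_right _ _) <| by
    refine ne_top_of_le_ne_top (hHfin (a / c) (by positivity)) (lintegral_mono fun t => ?_)
    simp only [ENNReal.ofReal_max, ENNReal.ofReal_zero, zero_le, sup_of_le_left]
    exact le_iSup (fun w => ENNReal.ofReal (-(a / c * ⟪gradient φ z, w - z⟫) - β t * ψ w)) (x t)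
  have hPmono : MonotoneOn P (Ici 0) := by
    have h := antitoneOn_Ici_of_hasDerivAt_nonpos cP.neg (fun t ht => (dP t ht).neg)
      fun t ht => neg_nonpos.2 (sq_nonneg ‖x' t‖)
    exact fun s hs t ht hst => neg_le_neg_iff.1 (h hs ht hst)
  have hQmono : MonotoneOn Q (Ici 0) := by
    have h := antitoneOn_Ici_of_hasDerivAt_nonpos cQ.neg (fun t ht => (dQ t ht).neg)
      fun t ht => neg_nonpos.2 (hβψ t ht.le)
    exact fun s hs t ht hst => neg_le_neg_iff.1 (h hs ht hst)
  have hPnonneg : ∀ t, 0 ≤ t → 0 ≤ P t := fun t ht => hP0 ▸ hPmono self_mem_Ici ht ht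
  have hQnonneg : ∀ t, 0 ≤ t → 0 ≤ Q t := fun t ht => hQ0 ▸ hQmono self_mem_Ici ht ht
  -- the Lyapunov estimate
  have hLyap : AntitoneOn (fun t => E t + a * D t + 2 * c * P t + c * Q t - c * M t) (Ici 0) := by
    refine antitoneOn_Ici_of_hasDerivAt_nonpos
      ((((cE.add (continuousOn_const.mul cD)).add (continuousOn_const.mul cP)).add
        (continuousOn_const.mul cQ)).sub (continuousOn_const.mul cM))
      (fun t ht => ((((dE t ht).add ((dD t ht).const_mul a)).add
        ((dP t ht).const_mul (2 * c))).add ((dQ t ht).const_mul c)).sub ((dM t ht).const_mul c))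
      fun t ht => ?_
    have h1 : a * ⟪gradient φ z, x t - z⟫ ≤ a * ⟪gradient φ (x t), x t - z⟫ :=
      mul_le_mul_of_nonneg_left ((hφz _).trans (hφx _)) ha0.le
    have h2 : a * (β t * ψ (x t)) ≤ a * (β t * ⟪gradient ψ (x t), x t - z⟫) :=
      mul_le_mul_of_nonneg_left
        (mul_le_mul_of_nonneg_left (hψx _) (hβpos t ht.le).le) ha0.le
    have h3 : β' t * ψ (x t) ≤ k * β t * ψ (x t) :=
      mul_le_mul_of_nonneg_right (hβgrowth t ht.le).2 (hψnonneg _)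
    have h4 : c * G t ≤ c * max (G t) 0 := mul_le_mul_of_nonneg_left (le_max_left _ _) hc0.le
    have h5 : c * G t = -(a * ⟪gradient φ z, x t - z⟫) - c * (β t * ψ (x t)) := by
      simp only [hG]
      field_simp
    simp only [Pi.mul_apply, Pi.pow_apply]
    have h6 : 2 * c = γ - a := by rw [hc, ha]; ring
    have h7 : a = k + 2 * c := by rw [hc, ha]; ring
    rw [h6]
    have h8 : a * (β t * ψ (x t)) = k * β t * ψ (x t) + 2 * c * (β t * ψ (x t)) := by
      nth_rewrite 1 [h7]; ring
    linarith
  have hform : ∀ t, 1 / 2 * (1 - a / γ) * ‖x' t‖ ^ 2 ≤ 1 / 2 * ‖x' t‖ ^ 2 + a * D t := by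
    intro t
    have h1 : -(‖x t - z‖ * ‖x' t‖) ≤ ⟪x t - z, x' t⟫ :=
      (abs_le.1 (abs_real_inner_le_norm _ _)).1
    have h2 : 0 ≤ a / (2 * γ) * (‖x' t‖ - γ * ‖x t - z‖) ^ 2 := by positivity
    have h3 : 1 / 2 * ‖x' t‖ ^ 2 + a * (-(‖x t - z‖ * ‖x' t‖) + γ / 2 * ‖x t - z‖ ^ 2)
        = 1 / 2 * (1 - a / γ) * ‖x' t‖ ^ 2 + a / (2 * γ) * (‖x' t‖ - γ * ‖x t - z‖) ^ 2 := by
      field_simp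
      ring
    have h4 := mul_le_mul_of_nonneg_left h1 ha0.le
    simp only [hD]
    linarith
  set κ : ℝ := 1 / 2 * (1 - a / γ) with hκ
  have hκ0 : 0 < κ := by
    have : a / γ < 1 := (div_lt_one hγ).2 (by linarith)
    linarith
  set C : ℝ := E 0 + a * D 0 + c * B - φ₀ with hC
  have hbound : ∀ t, 0 ≤ t → κ * ‖x' t‖ ^ 2 + 2 * c * P t + c * Q t ≤ C := by
    intro t ht
    have h1 := hLyap self_mem_Ici (mem_Ici.2 ht) ht
    simp only [hP0, hQ0, hM0] at h1
    have h2 := mul_le_mul_of_nonneg_left (hB t ht) hc0.le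
    have h3 := hform t
    have h4 : E t = 1 / 2 * ‖x' t‖ ^ 2 + φ (x t) + β t * ψ (x t) := rfl
    linarith [hφ₀ (x t), hβψ t ht]
  have hPB : ∀ t, 0 ≤ t → P t ≤ C / (2 * c) := fun t ht => by
    rw [le_div_iff₀ (by positivity)]
    nlinarith [hbound t ht, mul_nonneg hκ0.le (sq_nonneg ‖x' t‖),
      mul_nonneg hc0.le (hQnonneg t ht)]
  have hQB : ∀ t, 0 ≤ t → Q t ≤ C / c := fun t ht => by
    rw [le_div_iff₀ hc0]
    nlinarith [hbound t ht, mul_nonneg hκ0.le (sq_nonneg ‖x' t‖),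
      mul_nonneg hc0.le (hPnonneg t ht)]
  have hDB : ∀ t, 0 ≤ t → -(C / κ / (2 * γ)) ≤ D t := by
    intro t ht
    have h1 : -(‖x t - z‖ * ‖x' t‖) ≤ ⟪x t - z, x' t⟫ :=
      (abs_le.1 (abs_real_inner_le_norm _ _)).1
    have h2 : ‖x' t‖ ^ 2 ≤ C / κ := by
      rw [le_div_iff₀ hκ0]
      nlinarith [hbound t ht, mul_nonneg hc0.le (hPnonneg t ht),
        mul_nonneg hc0.le (hQnonneg t ht)]
    have h3 : 0 ≤ 1 / (2 * γ) * (‖x' t‖ - γ * ‖x t - z‖) ^ 2 := by positivity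
    have h4 : 1 / (2 * γ) * (‖x' t‖ - γ * ‖x t - z‖) ^ 2
        = ‖x' t‖ ^ 2 / (2 * γ) - ‖x t - z‖ * ‖x' t‖ + γ / 2 * ‖x t - z‖ ^ 2 := by
      field_simp
      ring
    have h5 : ‖x' t‖ ^ 2 / (2 * γ) ≤ C / κ / (2 * γ) :=
      div_le_div_of_nonneg_right h2 (by positivity)
    simp only [hD]
    linarith
  have hEanti : AntitoneOn (fun t => (E t - φ z) - k * Q t) (Ici 0) := by
    refine antitoneOn_Ici_of_hasDerivAt_nonpos
      ((cE.sub continuousOn_const).sub (continuousOn_const.mul cQ))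
      (fun t ht => ((dE t ht).sub_const (φ z)).sub ((dQ t ht).const_mul k)) fun t ht => ?_
    have h3 : β' t * ψ (x t) ≤ k * β t * ψ (x t) :=
      mul_le_mul_of_nonneg_right (hβgrowth t ht.le).2 (hψnonneg _)
    have h4 : 0 ≤ γ * ‖x' t‖ ^ 2 := by positivity
    simp only [Pi.mul_apply]
    linarith
  have hRanti : AntitoneOn (fun t => D t + R t - 3 / 2 * P t) (Ici 0) := by
    refine antitoneOn_Ici_of_hasDerivAt_nonpos
      ((cD.add cR).sub (continuousOn_const.mul cP))
      (fun t ht => ((dD t ht).add (dR t ht)).sub ((dP t ht).const_mul (3 / 2))) fun t ht => ?_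
    have h1 := hφx (x t)
    have h2 := mul_le_mul_of_nonneg_left (hψx (x t)) (hβpos t ht.le).le
    simp only [hE, Pi.pow_apply, Pi.sub_apply]
    linarith
  have hRB : ∀ t, 0 ≤ t → R t ≤ D 0 + C / κ / (2 * γ) + 3 / 2 * (C / (2 * c)) := by
    intro t ht
    have h := hRanti self_mem_Ici (mem_Ici.2 ht) ht
    simp only [hR0, hP0] at h
    linarith [hDB t ht, hPB t ht]
  -- the potential is asymptotically bounded below by `φ z`
  set I : ℝ := (∫⁻ t in Ici (0 : ℝ), ⨆ w : H,
      ENNReal.ofReal (-(1 * ⟪gradient φ z, w - z⟫) - β t * ψ w)).toReal with hI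
  have hlow : ∀ t, 0 < t → -⟪gradient φ z, x t - z⟫ - β t * ψ (x t) ≤ I / t := by
    intro t ht
    set r : ℝ := -⟪gradient φ z, x t - z⟫ - β t * ψ (x t) with hr
    have h1 : ENNReal.ofReal r * ENNReal.ofReal t ≤ ∫⁻ t in Ici (0 : ℝ), ⨆ w : H,
        ENNReal.ofReal (-(1 * ⟪gradient φ z, w - z⟫) - β t * ψ w) := by
      calc ENNReal.ofReal r * ENNReal.ofReal t
          = ∫⁻ _ in Icc (0 : ℝ) t, ENNReal.ofReal r := by simp
        _ ≤ ∫⁻ s in Icc (0 : ℝ) t, ⨆ w : H,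
            ENNReal.ofReal (-(1 * ⟪gradient φ z, w - z⟫) - β s * ψ w) := by
          refine setLIntegral_mono' measurableSet_Icc fun s hs => ?_
          refine le_trans (ENNReal.ofReal_le_ofReal ?_) (le_iSup (fun w =>
            ENNReal.ofReal (-(1 * ⟪gradient φ z, w - z⟫) - β s * ψ w)) (x t))
          have := mul_le_mul_of_nonneg_right (hβanti hs.1 ht.le hs.2) (hψnonneg (x t))
          rw [hr]
          linarith
        _ ≤ _ := lintegral_mono_set Icc_subset_Ici_self
    have h2 := ENNReal.toReal_mono (hHfin 1 zero_le_one) h1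
    rw [ENNReal.toReal_mul, ENNReal.toReal_ofReal ht.le, ENNReal.toReal_ofReal', ← hI] at h2
    rw [le_div_iff₀ ht]
    exact (mul_le_mul_of_nonneg_right (le_max_left _ _) ht.le).trans h2
  have hsq : ∀ t, 0 < t → ‖x' t‖ ^ 2 ≤ 2 * ((E t - φ z) + I / t) := by
    intro t ht
    have h4 : E t = 1 / 2 * ‖x' t‖ ^ 2 + φ (x t) + β t * ψ (x t) := rfl
    linarith [hlow t ht, hφz (x t)]
  have hI0 : Tendsto (fun t : ℝ => I / t) atTop (nhds 0) := tendsto_const_nhds.div_atTop tendsto_id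
  rw [Metric.tendsto_nhds]
  intro ε hε
  have hε' : 0 < ε ^ 2 / 5 := by positivity
  filter_upwards [eventually_le_of_antitoneOn_sub_of_antiderivative_le hk hEanti hQmono hQB cR dR
    hRB hε', hI0.eventually (gt_mem_nhds hε'), eventually_gt_atTop 0] with t h1 h2 ht
  rw [dist_zero_right, norm_norm]
  refine lt_of_pow_lt_pow_left₀ 2 hε.le ?_
  linarith [hsq t ht]
end
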